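/- Assume b_0 ≥ ν and let M be a matrix of full rank type. Then dim_ℂ (A/(J(1) + I_M))_{s_1} = b_0 − ν + 1, and for every integer l ≥ 2: dim_ℂ (A/(J(l) + I_M))_{s_l} = #{i ∈ {1,…,ν} : l is a convergent numerator of α_i/β_i}. (Equivalently, the Poincaré polynomial P_{m_X/m_X²}(t) = Σ_l Q(l) t^l equals (b_0 − ν + 1)t + Σ_{i=1}^ν f_{α_i,β_i}(t), where f_{α̃,β̃}(t) = Σ_k t^{p_k} sums over the convergent numerators p_k of α̃/β̃.) -/

import Mathlib

open scoped BigOperators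

/-- `s_l := l·b₀ − Σ_i ⌈l·ω_i/α_i⌉`. -/
noncomputable def sVal (ν : ℕ) (b0 : ℤ) (α ω : Fin ν → ℤ) (l : ℤ) : ℤ :=
  l * b0 - ∑ i, ⌈((l * ω i : ℤ) : ℚ) / (α i : ℚ)⌉

/-- `ε_{i,(l₁,l₂)} := {l₁·β_i/α_i} + {l₂·β_i/α_i} − {(l₁+l₂)·β_i/α_i}`. -/
noncomputable def epsQ (ν : ℕ) (α β : Fin ν → ℤ) (i : Fin ν) (l₁ l₂ : ℤ) : ℚ :=
  Int.fract (((l₁ * β i : ℤ) : ℚ) / (α i : ℚ)) + Int.fract (((l₂ * β i : ℤ) : ℚ) / (α i : ℚ)) -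
    Int.fract ((((l₁ + l₂) * β i : ℤ) : ℚ) / (α i : ℚ))

/-- The set of monomials `X_l := { ∏_i a_i^{ε_{i,(l₁,l₂)}} : (l₁,l₂) ∈ Λ_l }`. -/
noncomputable def Xset (ν : ℕ) (b0 : ℤ) (α ω β : Fin ν → ℤ) (l : ℤ) :
    Set (MvPolynomial (Fin ν) ℂ) :=
  { p | ∃ l₁ l₂ : ℤ, 1 ≤ l₁ ∧ 1 ≤ l₂ ∧ l₁ + l₂ = l ∧
      0 ≤ sVal ν b0 α ω l₁ ∧ 0 ≤ sVal ν b0 α ω l₂ ∧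
      p = ∏ i, MvPolynomial.X i ^ (if epsQ ν α β i l₁ l₂ = 1 then 1 else 0) }

/-- `J(l)`, the ideal of `A` generated by `X_l`. -/
noncomputable def Jl (ν : ℕ) (b0 : ℤ) (α ω β : Fin ν → ℤ) (l : ℤ) :
    Ideal (MvPolynomial (Fin ν) ℂ) :=
  Ideal.span (Xset ν b0 α ω β l)

/-- The dimension of the degree-`k` homogeneous component of `A/K`:
`dim_ℂ A_k − dim_ℂ (K ∩ A_k)`. -/
noncomputable def hdim {ν : ℕ} (K : Ideal (MvPolynomial (Fin ν) ℂ)) (k : ℕ) : ℕ :=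
  Module.finrank ℂ (MvPolynomial.homogeneousSubmodule (Fin ν) ℂ k) -
    Module.finrank ℂ
      (Submodule.restrictScalars ℂ K ⊓ MvPolynomial.homogeneousSubmodule (Fin ν) ℂ k :
        Submodule ℂ (MvPolynomial (Fin ν) ℂ))

/-- A `(ν−2)×ν` complex matrix is of full rank type if every `(ν−2)×(ν−2)` minor is nonzero. -/
def FullRankType (ν : ℕ) (M : Matrix (Fin (ν - 2)) (Fin ν) ℂ) : Prop :=
  ∀ g : Fin (ν - 2) ↪ Fin ν, (M.submatrix id g).det ≠ 0

/-- The ideal `I_M` generated by the `ν−2` linear forms `ℓ_j = Σ_i M_{j,i}·a_i`. -/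
noncomputable def IM {ν : ℕ} (M : Matrix (Fin (ν - 2)) (Fin ν) ℂ) :
    Ideal (MvPolynomial (Fin ν) ℂ) :=
  Ideal.span (Set.range fun j : Fin (ν - 2) =>
    ∑ i, MvPolynomial.C (M j i) * MvPolynomial.X i)

/-- Numerators `p_k` of the convergents of the negative continued fraction `cf[u_1,…]`:
`p_0 = 1`, `p_1 = u_1`, `p_{k+1} = u_{k+1}·p_k − p_{k−1}` (here `u k` stands for `u_{k+1}`). -/
def cfP (u : ℕ → ℤ) : ℕ → ℤ
  | 0 => 1
  | 1 => u 0
  | k + 2 => u (k + 1) * cfP u (k + 1) - cfP u k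

/-- Denominators `q_k` of the convergents: `q_0 = 0`, `q_1 = 1`,
`q_{k+1} = u_{k+1}·q_k − q_{k−1}`. -/
def cfQ (u : ℕ → ℤ) : ℕ → ℤ
  | 0 => 0
  | 1 => 1
  | k + 2 => u (k + 1) * cfQ u (k + 1) - cfQ u k

/-- `l` is a convergent numerator of `a/b` (for coprime `0 < b < a`): `l = p_k` for some
`1 ≤ k ≤ r` in the negative continued fraction expansion `a/b = cf[u_1,…,u_r]`. -/
def IsConvergentNumerator (a b l : ℤ) : Prop :=
  ∃ (r : ℕ) (u : ℕ → ℤ), 1 ≤ r ∧ (∀ k < r, 2 ≤ u k) ∧ cfP u r = a ∧ cfQ u r = b ∧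
    ∃ k : ℕ, 1 ≤ k ∧ k ≤ r ∧ cfP u k = l

theorem cfP_zero (u : ℕ → ℤ) : cfP u 0 = 1 := rfl
theorem cfP_add_two (u : ℕ → ℤ) (k : ℕ) :
    cfP u (k + 2) = u (k + 1) * cfP u (k + 1) - cfP u k := rfl
theorem cfQ_add_two (u : ℕ → ℤ) (k : ℕ) :
    cfQ u (k + 2) = u (k + 1) * cfQ u (k + 1) - cfQ u k := rfl

theorem cfP_mul_cfQ_succ_sub (u : ℕ → ℤ) (k : ℕ) :
    cfP u k * cfQ u (k + 1) - cfP u (k + 1) * cfQ u k = 1 := by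
  induction k with
  | zero => simp [cfP, cfQ]
  | succ k ih => rw [cfP_add_two, cfQ_add_two]; linear_combination ih

theorem cfP_lt_succ {u : ℕ → ℤ} {r : ℕ} (hu : ∀ k < r, 2 ≤ u k) {k : ℕ} (hk : k < r) :
    1 ≤ cfP u k ∧ cfP u k < cfP u (k + 1) := by
  induction k with
  | zero => have := hu 0 hk; simp [cfP]; omega
  | succ k ih =>
    obtain ⟨h1, h2⟩ := ih (by omega)
    have := hu _ hk
    rw [cfP_add_two]
    constructor <;> nlinarith

theorem cfP_mono {u : ℕ → ℤ} {r : ℕ} (hu : ∀ k < r, 2 ≤ u k) {k j : ℕ} (hkj : k ≤ j)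
    (hj : j ≤ r) : cfP u k ≤ cfP u j := by
  induction j, hkj using Nat.le_induction with
  | base => rfl
  | succ j hkj ih => exact (ih (by omega)).trans (cfP_lt_succ hu (by omega)).2.le

theorem cfP_pos {u : ℕ → ℤ} {r : ℕ} (hu : ∀ k < r, 2 ≤ u k) {k : ℕ} (hk : k ≤ r) :
    1 ≤ cfP u k :=
  cfP_mono hu (Nat.zero_le k) hk

theorem cfQ_mul_cfP_le {u : ℕ → ℤ} {r : ℕ} (hu : ∀ k < r, 2 ≤ u k) {k j : ℕ} (hkj : k ≤ j)
    (hj : j ≤ r) : cfQ u k * cfP u j ≤ cfP u k * cfQ u j := by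
  have key : ∀ i, k + i + 1 ≤ r → cfQ u k * cfP u (k + i) ≤ cfP u k * cfQ u (k + i) ∧
      cfP u k * cfQ u (k + i) - cfQ u k * cfP u (k + i) ≤
        cfP u k * cfQ u (k + i + 1) - cfQ u k * cfP u (k + i + 1) := by
    intro i hi
    induction i with
    | zero =>
      have := cfP_mul_cfQ_succ_sub u k
      simp only [add_zero]
      constructor <;> nlinarith
    | succ i ih =>
      obtain ⟨h1, h2⟩ := ih (by omega)
      have := hu (k + i + 1) (by omega)
      rw [← add_assoc, cfP_add_two, cfQ_add_two]
      constructor <;> nlinarith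
  obtain ⟨i, rfl⟩ := Nat.exists_eq_add_of_le hkj
  cases i with
  | zero => simp [mul_comm]
  | succ i =>
    obtain ⟨h1, h2⟩ := key i (by omega)
    rw [← add_assoc]
    linarith

theorem cf_cons (c : ℤ) (u : ℕ → ℤ) (k : ℕ) :
    (cfP (fun n => Nat.casesOn n c u) (k + 1) = c * cfP u k - cfQ u k ∧
      cfQ (fun n => Nat.casesOn n c u) (k + 1) = cfP u k) ∧
    (cfP (fun n => Nat.casesOn n c u) (k + 2) = c * cfP u (k + 1) - cfQ u (k + 1) ∧
      cfQ (fun n => Nat.casesOn n c u) (k + 2) = cfP u (k + 1)) := by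
  induction k with
  | zero => simp [cfP, cfQ]; ring
  | succ k ih =>
    obtain ⟨⟨h1, h2⟩, h3, h4⟩ := ih
    refine ⟨⟨h3, h4⟩, ?_⟩
    rw [cfP_add_two _ (k + 1), cfQ_add_two _ (k + 1), h3, h4, h1, h2, cfP_add_two u k,
      cfQ_add_two u k]
    constructor <;> ring

theorem exists_cf_expansion (n : ℕ) : ∀ a b : ℤ, b.toNat = n → 0 < b → b < a → IsCoprime a b →
    ∃ (r : ℕ) (u : ℕ → ℤ), 1 ≤ r ∧ (∀ k < r, 2 ≤ u k) ∧ cfP u r = a ∧ cfQ u r = b := by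
  induction n using Nat.strong_induction_on with
  | _ n ih =>
    intro a b hn hb hba hab
    rcases eq_or_lt_of_le (show 1 ≤ b from hb) with rfl | hb1
    · exact ⟨1, fun _ => a, le_rfl, fun _ _ => show (2 : ℤ) ≤ a by omega, rfl, rfl⟩
    obtain ⟨c, hc⟩ : ∃ c, c = a / b + 1 := ⟨_, rfl⟩
    have hdiv := Int.mul_ediv_add_emod a b
    have hlt := Int.emod_lt_of_pos a hb
    have hnn := Int.emod_nonneg a hb.ne'
    have hq : 1 ≤ a / b := (Int.le_ediv_iff_mul_le hb).2 (by omega)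
    have hcb : c * b - a = b - a % b := by rw [hc]; linarith
    have hne : a % b ≠ 0 := by
      intro h0
      have hd : b ∣ a := Int.dvd_of_emod_eq_zero h0
      have := hab.isUnit_of_dvd' hd dvd_rfl
      rcases Int.isUnit_iff.1 this with h | h <;> omega
    have hcop : IsCoprime b (c * b - a) := by
      have h := hab.symm.neg_right.add_mul_left_right c
      rwa [show -a + b * c = c * b - a by ring] at h
    obtain ⟨r, u, hr, hu, hP, hQ⟩ :=
      ih (c * b - a).toNat (by omega) b (c * b - a) rfl (by omega) (by omega) hcop
    refine ⟨r + 1, fun n => Nat.casesOn n c u, by omega, ?_, ?_, ?_⟩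
    · rintro (_ | k) hk
      · change 2 ≤ c
        omega
      · exact hu k (by omega)
    · rw [(cf_cons c u r).1.1, hP, hQ]; ring
    · rw [(cf_cons c u r).1.2, hP]

theorem isConvergentNumerator_iff {a b l : ℤ} (hb : 0 < b) (hba : b < a) (hab : IsCoprime a b)
    (hl : 2 ≤ l) : IsConvergentNumerator a b l ↔ ∀ l₁ l₂ : ℤ, 1 ≤ l₁ → 1 ≤ l₂ → l₁ + l₂ = l →
      l₁ * b / a + l₂ * b / a < l * b / a := by
  have ha : 0 < a := hb.trans hba
  constructor
  · rintro ⟨r, u, hr, hu, hP, hQ, k, hk1, hkr, rfl⟩ l₁ l₂ h1 h2 hl12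
    by_contra! hcon
    have no_point : ∀ x y : ℤ, 1 ≤ x → x < cfP u k → y * a ≤ x * b →
        cfQ u k * x ≤ cfP u k * y → False := by
      intro x y hx hxk hy hxy
      have key : ∀ j, k ≤ j → j ≤ r → cfQ u j * x < cfP u j * y := by
        intro j hkj
        induction j, hkj using Nat.le_induction with
        | base =>
          intro _
          refine lt_of_le_of_ne hxy fun heq => ?_
          have hdet := cfP_mul_cfQ_succ_sub u k
          have hdvd : cfP u k ∣ x := by
            refine ⟨x * cfQ u (k + 1) - y * cfP u (k + 1), ?_⟩
            linear_combination (-x) * hdet - cfP u (k + 1) * heq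
          have := Int.le_of_dvd (by omega) hdvd
          omega
        | succ j hkj ih =>
          intro hj
          have ht := ih (by omega)
          have hdet := cfP_mul_cfQ_succ_sub u j
          have hpj := cfP_pos hu (show j ≤ r by omega)
          have hpj' := cfP_pos hu hj
          have hxj : x < cfP u (j + 1) := hxk.trans_le (cfP_mono hu (by omega) hj)
          by_contra! hs
          have hx' : x = (cfQ u (j + 1) * x - cfP u (j + 1) * y) * cfP u j +
              (cfP u j * y - cfQ u j * x) * cfP u (j + 1) := by
            linear_combination (-x) * hdet
          nlinarith
      have := key r hkr le_rfl
      rw [hP, hQ] at this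
      linarith
    have hq : cfQ u k ≤ cfP u k * b / a := by
      rw [Int.le_ediv_iff_mul_le ha]
      have := cfQ_mul_cfP_le hu hkr le_rfl
      rwa [hP, hQ] at this
    have hy1 := Int.ediv_mul_le (l₁ * b) ha.ne'
    have hy2 := Int.ediv_mul_le (l₂ * b) ha.ne'
    have hp := cfP_pos hu hkr
    rcases le_total (cfQ u k * l₁) (cfP u k * (l₁ * b / a)) with h | h
    · exact no_point _ _ h1 (by omega) hy1 h
    · refine no_point l₂ (l₂ * b / a) h2 (by omega) hy2 ?_
      have hsum : cfQ u k * (l₁ + l₂) ≤ cfP u k * (l₁ * b / a + l₂ * b / a) := by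
        rw [hl12, mul_comm]
        exact mul_le_mul_of_nonneg_left (hq.trans hcon) (by omega)
      linarith
  · intro hind
    obtain ⟨r, u, hr, hu, hP, hQ⟩ := exists_cf_expansion _ a b rfl hb hba hab
    refine ⟨r, u, hr, hu, hP, hQ, ?_⟩
    obtain ⟨m, hm⟩ : ∃ m, m = l * b / a := ⟨_, rfl⟩
    have hma : m * a ≤ l * b := hm ▸ Int.ediv_mul_le _ ha.ne'
    have hm0 : 0 ≤ m := hm ▸ Int.ediv_nonneg (by positivity) ha.le
    have split : ∀ x y : ℤ, 1 ≤ x → 1 ≤ l - x → y * a ≤ x * b → (m - y) * a ≤ (l - x) * b →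
        False := by
      intro x y h1 h2 h3 h4
      have := hind x (l - x) h1 h2 (by ring)
      have h5 := (Int.le_ediv_iff_mul_le ha).2 h3
      have h6 := (Int.le_ediv_iff_mul_le ha).2 h4
      omega
    by_cases hr0 : cfQ u r * l ≤ cfP u r * m
    · refine ⟨r, hr, le_rfl, ?_⟩
      rw [hP, hQ] at hr0
      have heq : a * m = b * l := by linarith
      have hdvd : a ∣ l := hab.dvd_of_dvd_mul_left ⟨m, heq.symm⟩
      have hal := Int.le_of_dvd (by omega) hdvd
      rw [hP]
      by_contra hne
      exact split a b (by omega) (by omega) (by linarith) (by linarith)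
    · have hex : ∃ k < r, cfQ u k * l ≤ cfP u k * m ∧ cfP u (k + 1) * m < cfQ u (k + 1) * l := by
        by_contra! hno
        have : ∀ k ≤ r, cfQ u k * l ≤ cfP u k * m := by
          intro k
          induction k with
          | zero => intro _; simpa [cfP, cfQ] using hm0
          | succ k ih => intro hk; exact hno k (by omega) (ih (by omega))
        exact hr0 (this r le_rfl)
      obtain ⟨k, hkr, ht, hs⟩ := hex
      have hdet := cfP_mul_cfQ_succ_sub u k
      obtain ⟨hp, hpp⟩ := cfP_lt_succ hu hkr
      have hD := cfQ_mul_cfP_le hu hkr.le le_rfl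
      have hD' := cfQ_mul_cfP_le hu (show k + 1 ≤ r from hkr) le_rfl
      rw [hP, hQ] at hD hD'
      obtain ⟨s, hs'⟩ : ∃ s, s = cfQ u (k + 1) * l - cfP u (k + 1) * m - 1 := ⟨_, rfl⟩
      obtain ⟨t, ht'⟩ : ∃ t, t = cfP u k * m - cfQ u k * l := ⟨_, rfl⟩
      have hs0 : 0 ≤ s := by omega
      have ht0 : 0 ≤ t := by omega
      have hl' : l - cfP u k = s * cfP u k + t * cfP u (k + 1) := by
        rw [hs', ht']; linear_combination (-l) * hdet
      have hm' : m - cfQ u k = s * cfQ u k + t * cfQ u (k + 1) := by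
        rw [hs', ht']; linear_combination (-m) * hdet
      have hlk : l = cfP u k := by
        by_contra hne
        have h0 : 0 ≤ s * cfP u k + t * cfP u (k + 1) := by
          have : 0 ≤ cfP u k := by omega
          have : 0 ≤ cfP u (k + 1) := by omega
          positivity
        refine split (cfP u k) (cfQ u k) hp (by omega) hD ?_
        rw [hl', hm']
        have e1 := mul_le_mul_of_nonneg_left hD hs0
        have e2 := mul_le_mul_of_nonneg_left hD' ht0
        linarith
      refine ⟨k, Nat.pos_of_ne_zero ?_, hkr.le, hlk.symm⟩
      rintro rfl
      rw [cfP_zero] at hlk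
      omega

theorem FullRankType.eq_zero {ν : ℕ} {M : Matrix (Fin (ν - 2)) (Fin ν) ℂ} (hM : FullRankType ν M)
    {x : Fin ν → ℂ} (hx : M.mulVec x = 0) {i j : Fin ν} (hij : i ≠ j) (hi : x i = 0)
    (hj : x j = 0) : x = 0 := by
  have hcard : (({i, j} : Finset (Fin ν))ᶜ).card = ν - 2 := by
    rw [Finset.card_compl, Finset.card_pair hij, Fintype.card_fin]
  let g := (({i, j} : Finset (Fin ν))ᶜ).orderEmbOfFin hcard
  have hzero : ∀ s, s ∉ Set.range g → x s = 0 := by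
    intro s hs
    rw [Finset.range_orderEmbOfFin] at hs
    simp only [Finset.coe_compl, Set.mem_compl_iff, not_not, Finset.mem_coe, Finset.mem_insert,
      Finset.mem_singleton] at hs
    rcases hs with rfl | rfl <;> assumption
  have hsub : (M.submatrix id g.toEmbedding).mulVec (x ∘ g) = 0 := by
    ext t
    rw [← hx]
    simp only [Matrix.mulVec, dotProduct, Matrix.submatrix_apply, id, Function.comp]
    refine Fintype.sum_of_injective g g.injective _ _ (fun s hs => ?_) fun _ => rfl
    rw [hzero s hs, mul_zero]
  have h0 := Matrix.eq_zero_of_mulVec_eq_zero (hM g.toEmbedding) hsub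
  ext s
  by_cases hs : s ∈ Set.range g
  · obtain ⟨t, rfl⟩ := hs
    exact congrFun h0 t
  · exact hzero s hs

theorem FullRankType.exists_point {ν : ℕ} (hν : 2 ≤ ν) {M : Matrix (Fin (ν - 2)) (Fin ν) ℂ}
    (hM : FullRankType ν M) (i : Fin ν) :
    ∃ x : Fin ν → ℂ, M.mulVec x = 0 ∧ x i = 0 ∧ ∀ j, j ≠ i → x j ≠ 0 := by
  let f : (Fin ν → ℂ) →ₗ[ℂ] (Fin (ν - 2) → ℂ) × ℂ := M.mulVecLin.prod (LinearMap.proj i)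
  have hker : LinearMap.ker f ≠ ⊥ := by
    apply LinearMap.ker_ne_bot_of_finrank_lt
    simp only [Module.finrank_prod, Module.finrank_fin_fun, Module.finrank_self]
    omega
  obtain ⟨x, hx, hx0⟩ := (Submodule.ne_bot_iff _).1 hker
  have hx' : M.mulVec x = 0 ∧ x i = 0 := by simpa [f] using hx
  exact ⟨x, hx'.1, hx'.2, fun j hj h => hx0 (hM.eq_zero hx'.1 hj h hx'.2)⟩

theorem mem_span_of_dotProduct_eq_zero {ν : ℕ} {M : Matrix (Fin (ν - 2)) (Fin ν) ℂ}
    {s : Set (Fin ν)} {w : Fin ν → ℂ}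
    (hw : ∀ y : Fin ν → ℂ, M.mulVec y = 0 → (∀ i ∈ s, y i = 0) → y ⬝ᵥ w = 0) :
    w ∈ Submodule.span ℂ ((fun i => Pi.single i 1) '' s ∪ Set.range M.row) := by
  by_contra hmem
  obtain ⟨φ, hφw, hφ⟩ := Submodule.exists_le_ker_of_notMem hmem
  obtain ⟨y, rfl⟩ := (dotProductEquiv ℂ (Fin ν)).surjective φ
  refine hφw (hw y ?_ fun i hi => ?_)
  · ext t
    have : y ⬝ᵥ M.row t = 0 := hφ (Submodule.subset_span (Or.inr ⟨t, rfl⟩))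
    rwa [dotProduct_comm] at this
  · simpa using hφ (Submodule.subset_span (Or.inl ⟨i, hi, rfl⟩))

open MvPolynomial

/-- The linear form with a given coefficient vector. -/
noncomputable def linearForm (ν : ℕ) : (Fin ν → ℂ) →ₗ[ℂ] MvPolynomial (Fin ν) ℂ :=
  Fintype.linearCombination ℂ X

theorem linearForm_apply {ν : ℕ} (w : Fin ν → ℂ) : linearForm ν w = ∑ i, C (w i) * X i := by
  simp [linearForm, Fintype.linearCombination_apply, smul_eq_C_mul]

theorem linearForm_mem {ν : ℕ} {M : Matrix (Fin (ν - 2)) (Fin ν) ℂ} {s : Set (Fin ν)}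
    {w : Fin ν → ℂ}
    (hw : ∀ y : Fin ν → ℂ, M.mulVec y = 0 → (∀ i ∈ s, y i = 0) → y ⬝ᵥ w = 0) :
    linearForm ν w ∈ IM M ⊔ Ideal.span (X '' s) := by
  have : Submodule.span ℂ ((fun i => Pi.single i 1) '' s ∪ Set.range M.row) ≤
      ((IM M ⊔ Ideal.span (X '' s)).restrictScalars ℂ).comap (linearForm ν) := by
    rw [Submodule.span_le]
    rintro _ (⟨i, hi, rfl⟩ | ⟨j, rfl⟩)
    · refine Ideal.mem_sup_right (Ideal.subset_span ⟨i, hi, ?_⟩)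
      simp [linearForm]
    · refine Ideal.mem_sup_left (Ideal.subset_span ⟨j, ?_⟩)
      simp [linearForm_apply]
  exact this (mem_span_of_dotProduct_eq_zero hw)

theorem mem_of_retraction {σ R : Type*} [CommRing R] [Algebra ℂ R] {I : Ideal (MvPolynomial σ ℂ)}
    (ψ : MvPolynomial σ ℂ →ₐ[ℂ] R) (τ : R →ₐ[ℂ] MvPolynomial σ ℂ)
    (h : ∀ j, X j - τ (ψ (X j)) ∈ I) {f : MvPolynomial σ ℂ} (hf : ψ f = 0) : f ∈ I := by
  have heq : Ideal.Quotient.mkₐ ℂ I = ((Ideal.Quotient.mkₐ ℂ I).comp τ).comp ψ := by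
    ext j
    simpa using (Ideal.Quotient.eq.2 (h j))
  have := congrArg (fun F => F f) heq
  simp only [AlgHom.comp_apply, hf, map_zero] at this
  exact Ideal.Quotient.eq_zero_iff_mem.1 this

theorem hdim_eq_finrank_map {ν : ℕ} {V : Type*} [AddCommGroup V] [Module ℂ V]
    (K : Ideal (MvPolynomial (Fin ν) ℂ)) (k : ℕ) (T : MvPolynomial (Fin ν) ℂ →ₗ[ℂ] V)
    (hker : ∀ f : MvPolynomial (Fin ν) ℂ, f.IsHomogeneous k → (f ∈ K ↔ T f = 0)) :
    hdim K k = Module.finrank ℂ ((homogeneousSubmodule (Fin ν) ℂ k).map T) := by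
  have : Module.Finite ℂ (homogeneousSubmodule (Fin ν) ℂ k) :=
    Module.Finite.iff_fg.2 (homogeneousSubmodule_fg _ _ _)
  have h1 := (T.domRestrict (homogeneousSubmodule (Fin ν) ℂ k)).finrank_range_add_finrank_ker
  have h2 : (LinearMap.ker (T.domRestrict (homogeneousSubmodule (Fin ν) ℂ k))).map
      (homogeneousSubmodule (Fin ν) ℂ k).subtype =
      K.restrictScalars ℂ ⊓ homogeneousSubmodule (Fin ν) ℂ k := by
    ext f
    simp only [Submodule.mem_map, LinearMap.mem_ker, Submodule.mem_inf,
      Submodule.restrictScalars_mem]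
    constructor
    · rintro ⟨⟨g, hg⟩, hT, rfl⟩
      exact ⟨(hker g hg).2 hT, hg⟩
    · rintro ⟨hK, hf⟩
      exact ⟨⟨f, hf⟩, (hker f hf).1 hK, rfl⟩
  rw [LinearMap.range_domRestrict] at h1
  rw [hdim, ← h2, Submodule.finrank_map_subtype_eq]
  omega

/-- Restriction of polynomials to the line through the origin spanned by `x`. -/
noncomputable def lineMap {ν : ℕ} (x : Fin ν → ℂ) : MvPolynomial (Fin ν) ℂ →ₐ[ℂ] Polynomial ℂ :=
  aeval fun j => Polynomial.C (x j) * Polynomial.X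

theorem lineMap_X {ν : ℕ} (x : Fin ν → ℂ) (j : Fin ν) :
    lineMap x (X j) = Polynomial.C (x j) * Polynomial.X := by
  simp [lineMap]

theorem lineMap_eq_of_isHomogeneous {ν : ℕ} (x : Fin ν → ℂ) {f : MvPolynomial (Fin ν) ℂ} {k : ℕ}
    (hf : f.IsHomogeneous k) : lineMap x f = Polynomial.C (eval x f) * Polynomial.X ^ k := by
  conv_lhs => rw [f.as_sum]
  rw [eval_eq', map_sum, map_sum, Finset.sum_mul]
  refine Finset.sum_congr rfl fun d hd => ?_
  have hdeg : ∑ i, d i = k := by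
    rw [← Finsupp.degree_eq_sum, hf.degree_eq_sum_deg_support hd, Finsupp.degree_apply]
  rw [lineMap, aeval_monomial, Finsupp.prod_fintype _ _ (by simp), ← hdeg]
  simp [mul_pow, Finset.prod_mul_distrib, Finset.prod_pow_eq_pow_sum, mul_assoc]

theorem map_eq_zero_of_mem_IM {ν : ℕ} {R : Type*} [CommRing R] [Algebra ℂ R]
    {M : Matrix (Fin (ν - 2)) (Fin ν) ℂ} (ψ : MvPolynomial (Fin ν) ℂ →ₐ[ℂ] R)
    (h : ∀ t, ∑ j, algebraMap ℂ R (M t j) * ψ (X j) = 0)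
    {f : MvPolynomial (Fin ν) ℂ} (hf : f ∈ IM M) : ψ f = 0 := by
  have : IM M ≤ RingHom.ker ψ := by
    rw [IM, Ideal.span_le]
    rintro _ ⟨t, rfl⟩
    simpa [RingHom.mem_ker, ← algebraMap_eq] using h t
  exact this hf

theorem lineMap_eq_zero_of_mem_IM {ν : ℕ} {M : Matrix (Fin (ν - 2)) (Fin ν) ℂ} {x : Fin ν → ℂ}
    (hx : M.mulVec x = 0) {f : MvPolynomial (Fin ν) ℂ} (hf : f ∈ IM M) : lineMap x f = 0 := by
  refine map_eq_zero_of_mem_IM _ (fun t => ?_) hf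
  have := congrArg (fun c => Polynomial.C c * Polynomial.X) (congrFun hx t)
  simpa [lineMap_X, Matrix.mulVec, dotProduct, Finset.sum_mul, ← mul_assoc] using this

theorem mem_of_lineMap_eq_zero {ν : ℕ} {M : Matrix (Fin (ν - 2)) (Fin ν) ℂ}
    (hM : FullRankType ν M) {i q : Fin ν} (hq : q ≠ i) {x : Fin ν → ℂ} (hx : M.mulVec x = 0)
    (hxi : x i = 0) (hxq : x q ≠ 0) {f : MvPolynomial (Fin ν) ℂ} (hf : lineMap x f = 0) :
    f ∈ IM M ⊔ Ideal.span {X i} := by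
  refine mem_of_retraction (lineMap x) (Polynomial.aeval (C (x q)⁻¹ * X q)) (fun j => ?_) hf
  have hlin : X j - Polynomial.aeval (C (x q)⁻¹ * X q) (lineMap x (X j)) =
      linearForm ν (Pi.single j 1 - (x j * (x q)⁻¹) • Pi.single q 1) := by
    simp [lineMap_X, linearForm, smul_eq_C_mul, algebraMap_eq, mul_assoc]
  rw [hlin, ← Set.image_singleton]
  refine linearForm_mem fun y hy hyi => ?_
  have h0 : y - (y q / x q) • x = 0 := by
    refine hM.eq_zero ?_ hq ?_ ?_
    · rw [Matrix.mulVec_sub, Matrix.mulVec_smul, hx, hy, smul_zero, sub_zero]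
    · simp [div_mul_cancel₀ _ hxq]
    · simp [hxi, hyi i rfl]
  rw [sub_eq_zero.1 h0]
  simp
  field_simp
  simp

theorem mem_sup_span_prod_of_lineMap_eq_zero {ν : ℕ} (hν : 2 ≤ ν)
    {M : Matrix (Fin (ν - 2)) (Fin ν) ℂ} (hM : FullRankType ν M) {P : Fin ν → Fin ν → ℂ}
    (hP : ∀ i, M.mulVec (P i) = 0) (hPi : ∀ i, P i i = 0) (hPj : ∀ i j, j ≠ i → P i j ≠ 0)
    (S : Finset (Fin ν)) {f : MvPolynomial (Fin ν) ℂ} (hf : ∀ i ∈ S, lineMap (P i) f = 0) :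
    f ∈ IM M ⊔ Ideal.span {∏ i ∈ S, X i} := by
  have : Nontrivial (Fin ν) := Fin.nontrivial_iff_two_le.2 hν
  induction S using Finset.induction_on with
  | empty => simp
  | insert i S hi ih =>
    obtain ⟨m, hm, _, ha, rfl⟩ :=
      Submodule.mem_sup.1 (ih fun j hj => hf j (Finset.mem_insert_of_mem hj))
    obtain ⟨g, rfl⟩ := Ideal.mem_span_singleton'.1 ha
    have hg : lineMap (P i) g = 0 := by
      have h := hf i (Finset.mem_insert_self _ _)
      rw [map_add, lineMap_eq_zero_of_mem_IM (hP i) hm, zero_add, map_mul, map_prod] at h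
      refine (mul_eq_zero.1 h).resolve_right (Finset.prod_ne_zero_iff.2 fun j hj => ?_)
      rw [lineMap_X]
      have hji : j ≠ i := fun hji => hi (hji ▸ hj)
      exact mul_ne_zero (Polynomial.C_ne_zero.2 (hPj i j hji)) Polynomial.X_ne_zero
    obtain ⟨q, hq⟩ := exists_ne i
    obtain ⟨m', hm', _, ha', rfl⟩ :=
      Submodule.mem_sup.1 (mem_of_lineMap_eq_zero hM hq (hP i) (hPi i) (hPj i q hq) hg)
    obtain ⟨h, rfl⟩ := Ideal.mem_span_singleton'.1 ha'
    rw [add_mul, ← add_assoc]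
    refine Submodule.add_mem_sup (Ideal.add_mem _ hm (Ideal.mul_mem_right _ _ hm')) ?_
    rw [Finset.prod_insert hi, mul_assoc]
    exact Ideal.mul_mem_left _ _ (Ideal.mem_span_singleton_self _)

theorem hdim_sup_IM_eq_card {ν : ℕ} (hν : 2 ≤ ν) {M : Matrix (Fin (ν - 2)) (Fin ν) ℂ}
    (hM : FullRankType ν M) (J : Ideal (MvPolynomial (Fin ν) ℂ)) {S D : Finset (Fin ν)} {k : ℕ}
    (hDS : D ⊆ S) (hSk : S.card ≤ k) (hJD : ∀ i ∈ D, J ≤ Ideal.span {X i})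
    (hJS : ∏ i ∈ S, X i ∈ J) (hJn : ∀ n ∈ S, n ∉ D → ∏ i ∈ S.erase n, X i ∈ J) :
    hdim (J ⊔ IM M) k = D.card := by
  have : Nontrivial (Fin ν) := Fin.nontrivial_iff_two_le.2 hν
  choose P hP hPi hPj using hM.exists_point hν
  choose m hm using fun n : Fin ν => exists_ne n
  let B : Fin ν → MvPolynomial (Fin ν) ℂ := fun n =>
    (∏ i ∈ S.erase n, X i) * X (m n) ^ (k - (S.card - 1))
  have hBhom : ∀ n ∈ S, (B n).IsHomogeneous k := by
    intro n hn
    have h := (IsHomogeneous.prod (S.erase n) (fun i => (X i : MvPolynomial (Fin ν) ℂ))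
      (fun _ => 1) fun i _ => isHomogeneous_X ℂ i).mul
      (isHomogeneous_X_pow (R := ℂ) (m n) (k - (S.card - 1)))
    convert h using 1
    rw [Finset.sum_const, Finset.card_erase_of_mem hn, smul_eq_mul, mul_one]
    omega
  have hBzero : ∀ i ∈ S, ∀ n, i ≠ n → eval (P i) (B n) = 0 := by
    intro i hi n hin
    rw [map_mul, map_prod,
      Finset.prod_eq_zero (Finset.mem_erase.2 ⟨hin, hi⟩) (by rw [eval_X, hPi]), zero_mul]
  have hBne : ∀ n, eval (P n) (B n) ≠ 0 := by
    intro n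
    rw [map_mul, map_prod, map_pow, eval_X]
    refine mul_ne_zero (Finset.prod_ne_zero_iff.2 fun i hi => ?_) (pow_ne_zero _ (hPj n _ (hm n)))
    rw [eval_X]
    exact hPj n i (Finset.ne_of_mem_erase hi)
  have hinterp : ∀ U ⊆ S, ∀ v : Fin ν → ℂ, ∀ i ∈ S,
      eval (P i) (∑ n ∈ U, C (v n / eval (P n) (B n)) * B n) = if i ∈ U then v i else 0 := by
    intro U hU v i hi
    simp only [map_sum, map_mul, eval_C]
    split_ifs with hiU
    · rw [Finset.sum_eq_single_of_mem i hiU fun n _ hn => by rw [hBzero i hi n hn.symm, mul_zero],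
        div_mul_cancel₀ _ (hBne i)]
    · refine Finset.sum_eq_zero fun n hn => ?_
      rw [hBzero i hi n fun h => hiU (h ▸ hn), mul_zero]
  have hinterp_hom : ∀ U ⊆ S, ∀ v : Fin ν → ℂ,
      (∑ n ∈ U, C (v n / eval (P n) (B n)) * B n).IsHomogeneous k := fun U hU v =>
    IsHomogeneous.sum _ _ _ fun n hn => (hBhom n (hU hn)).C_mul _
  have hvanish : ∀ i ∈ D, ∀ f ∈ J ⊔ IM M, lineMap (P i) f = 0 := by
    intro i hi f hf
    obtain ⟨a, ha, b, hb, rfl⟩ := Submodule.mem_sup.1 hf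
    obtain ⟨g, rfl⟩ := Ideal.mem_span_singleton'.1 (hJD i hi ha)
    rw [map_add, lineMap_eq_zero_of_mem_IM (hP i) hb, map_mul, lineMap_X, hPi]
    simp
  have hline : ∀ i (f : MvPolynomial (Fin ν) ℂ), f.IsHomogeneous k →
      (lineMap (P i) f = 0 ↔ eval (P i) f = 0) := by
    intro i f hf
    rw [lineMap_eq_of_isHomogeneous _ hf, mul_eq_zero, Polynomial.C_eq_zero]
    simp [Polynomial.X_ne_zero]
  let T : MvPolynomial (Fin ν) ℂ →ₗ[ℂ] (D → ℂ) := LinearMap.pi fun i => (aeval (P i)).toLinearMap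
  have hT : ∀ f i, T f i = eval (P i) f := fun f i => by simp [T, aeval_eq_eval]
  rw [hdim_eq_finrank_map _ k T]
  · have htop : (homogeneousSubmodule (Fin ν) ℂ k).map T = ⊤ := by
      rw [eq_top_iff]
      intro v _
      refine ⟨_, hinterp_hom D hDS fun n => if h : n ∈ D then v ⟨n, h⟩ else 0, ?_⟩
      ext ⟨i, hi⟩
      rw [hT, hinterp D hDS _ i (hDS hi)]
      simp [hi]
    rw [htop, finrank_top, Module.finrank_fintype_fun_eq_card, Fintype.card_coe]
  intro f hf
  constructor
  · intro hfK
    ext i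
    rw [hT]
    exact (hline i f hf).1 (hvanish i i.2 f hfK)
  · intro hTf
    have hfD : ∀ i ∈ D, eval (P i) f = 0 := fun i hi => by
      rw [← hT f ⟨i, hi⟩, hTf]; rfl
    let c := ∑ n ∈ S \ D, C (eval (P n) f / eval (P n) (B n)) * B n
    have hsub : S \ D ⊆ S := Finset.sdiff_subset
    have hc : c ∈ J := by
      refine Ideal.sum_mem _ fun n hn => Ideal.mul_mem_left _ _ (Ideal.mul_mem_right _ _ ?_)
      exact hJn n (Finset.mem_sdiff.1 hn).1 (Finset.mem_sdiff.1 hn).2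
    have hrem : f - c ∈ IM M ⊔ Ideal.span {∏ i ∈ S, X i} := by
      refine mem_sup_span_prod_of_lineMap_eq_zero hν hM hP hPi hPj S fun i hi => ?_
      rw [hline i _ (hf.sub (hinterp_hom _ hsub fun n => eval (P n) f)), map_sub,
        hinterp _ hsub (fun n => eval (P n) f) i hi]
      by_cases hiD : i ∈ D
      · simp [hiD, hfD i hiD]
      · simp [hiD, hi]
    have hle : IM M ⊔ Ideal.span {∏ i ∈ S, X i} ≤ J ⊔ IM M :=
      sup_le le_sup_right (((Ideal.span_singleton_le_iff_mem _).2 hJS).trans le_sup_left)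
    have := Ideal.add_mem _ (hle hrem) (Ideal.mem_sup_left hc)
    rwa [sub_add_cancel] at this

theorem finrank_homogeneousSubmodule_fin_two (k : ℕ) :
    Module.finrank ℂ (homogeneousSubmodule (Fin 2) ℂ k) = k + 1 := by
  rw [homogeneousSubmodule_eq_finsupp_supported]
  refine (Module.finrank_eq_nat_card_basis (basisRestrictSupport ℂ _)).trans ?_
  have e : {d : Fin 2 →₀ ℕ | d.degree = k} ≃
      {x : ℕ × ℕ // x ∈ Finset.HasAntidiagonal.antidiagonal k} :=
    (Finsupp.equivFunOnFinite.trans (finTwoArrowEquiv ℕ)).subtypeEquiv fun d => by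
      simp [Finsupp.degree_eq_sum]
  rw [Nat.card_congr e, Nat.card_eq_fintype_card, Fintype.card_coe, Finset.Nat.card_antidiagonal]

theorem hdim_IM {ν : ℕ} (hν : 2 ≤ ν) {M : Matrix (Fin (ν - 2)) (Fin ν) ℂ}
    (hM : FullRankType ν M) (k : ℕ) : hdim (IM M) k = k + 1 := by
  have : Nontrivial (Fin ν) := Fin.nontrivial_iff_two_le.2 hν
  obtain ⟨p, q, hpq⟩ := exists_pair_ne (Fin ν)
  obtain ⟨u, hu, hup, huj⟩ := hM.exists_point hν p
  obtain ⟨v, hv, hvq, hvj⟩ := hM.exists_point hν q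
  have huq := huj q hpq.symm
  have hvp := hvj p hpq
  let ψ : MvPolynomial (Fin ν) ℂ →ₐ[ℂ] MvPolynomial (Fin 2) ℂ :=
    aeval fun j => C (u j) * X 0 + C (v j) * X 1
  let τ : MvPolynomial (Fin 2) ℂ →ₐ[ℂ] MvPolynomial (Fin ν) ℂ :=
    aeval ![C (u q)⁻¹ * X q, C (v p)⁻¹ * X p]
  have hψτ : ∀ g, ψ (τ g) = g := by
    intro g
    have : ψ.comp τ = AlgHom.id ℂ _ := by
      refine algHom_ext fun i => ?_
      fin_cases i
      · simp only [ψ, τ, AlgHom.comp_apply, aeval_X, Fin.zero_eta, Matrix.cons_val_zero, map_mul,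
          aeval_C, algebraMap_eq, hvq, map_zero, zero_mul, add_zero, ← mul_assoc]
        simp [← map_mul, huq]
      · simp only [ψ, τ, AlgHom.comp_apply, aeval_X, Fin.mk_one, Matrix.cons_val_one,
          Matrix.cons_val_fin_one, map_mul, aeval_C, algebraMap_eq, hup, map_zero,
          zero_mul, zero_add, ← mul_assoc]
        simp [← map_mul, hvp]
    exact congrArg (fun F => F g) this
  rw [hdim_eq_finrank_map _ k ψ.toLinearMap]
  · have hmap : (homogeneousSubmodule (Fin ν) ℂ k).map ψ.toLinearMap =
        homogeneousSubmodule (Fin 2) ℂ k := by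
      ext g
      constructor
      · rintro ⟨f, hf, rfl⟩
        have h := IsHomogeneous.aeval (n := 1) (S := ℂ) hf
          (fun j => C (u j) * (X 0 : MvPolynomial (Fin 2) ℂ) + C (v j) * X 1)
          fun j => (isHomogeneous_C_mul_X _ _).add (isHomogeneous_C_mul_X _ _)
        rwa [one_mul] at h
      · intro hg
        refine ⟨τ g, ?_, hψτ g⟩
        have h := IsHomogeneous.aeval (n := 1) (S := ℂ) hg
          ![C (u q)⁻¹ * (X q : MvPolynomial (Fin ν) ℂ), C (v p)⁻¹ * X p]
          fun i => by fin_cases i <;> exact isHomogeneous_C_mul_X _ _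
        rwa [one_mul] at h
    rw [hmap, finrank_homogeneousSubmodule_fin_two]
  · intro f _
    refine ⟨fun hf => map_eq_zero_of_mem_IM ψ (fun t => ?_) hf, fun hf => ?_⟩
    · have h1 := congrArg (fun c => C c * (X 0 : MvPolynomial (Fin 2) ℂ)) (congrFun hu t)
      have h2 := congrArg (fun c => C c * (X 1 : MvPolynomial (Fin 2) ℂ)) (congrFun hv t)
      simp only [Matrix.mulVec, dotProduct, map_sum, map_mul, Finset.sum_mul, Pi.zero_apply,
        map_zero, zero_mul] at h1 h2
      simp only [ψ, aeval_X, mul_add, Finset.sum_add_distrib, algebraMap_eq, ← mul_assoc, h1, h2,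
        add_zero]
    · refine mem_of_retraction ψ τ (fun j => ?_) hf
      have hlin : X j - τ (ψ (X j)) = linearForm ν (Pi.single j 1 -
          ((u j * (u q)⁻¹) • Pi.single q 1 + (v j * (v p)⁻¹) • Pi.single p 1)) := by
        simp [ψ, τ, linearForm, smul_eq_C_mul, algebraMap_eq, mul_assoc]
      have := linearForm_mem (M := M) (s := ∅)
        (w := Pi.single j 1 -
          ((u j * (u q)⁻¹) • Pi.single q 1 + (v j * (v p)⁻¹) • Pi.single p 1)) fun y hy _ => ?_
      · rw [hlin]
        simpa using this
      · have h0 : y - ((y q / u q) • u + (y p / v p) • v) = 0 := by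
          refine hM.eq_zero ?_ hpq ?_ ?_
          · rw [Matrix.mulVec_sub, Matrix.mulVec_add, Matrix.mulVec_smul, Matrix.mulVec_smul, hu,
              hv, hy]
            simp
          · simp [hup, div_mul_cancel₀ _ hvp]
          · simp [hvq, div_mul_cancel₀ _ huq]
        rw [sub_eq_zero.1 h0]
        simp [hup, hvq]
        field_simp
        ring

theorem floor_intCast_div {n d : ℤ} (hd : 0 < d) : ⌊((n : ℤ) : ℚ) / (d : ℚ)⌋ = n / d := by
  lift d to ℕ using hd.le
  exact Rat.floor_intCast_div_natCast n d

theorem sVal_eq {ν : ℕ} (b0 : ℤ) {α ω β : Fin ν → ℤ} (hα : ∀ i, 0 < α i)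
    (hβ : ∀ i, β i = α i - ω i) (l : ℤ) :
    sVal ν b0 α ω l = l * (b0 - ν) + ∑ i, l * β i / α i := by
  have h : ∀ i, l * β i / α i = l - ⌈((l * ω i : ℤ) : ℚ) / (α i : ℚ)⌉ := by
    intro i
    have hi : (α i : ℚ) ≠ 0 := by exact_mod_cast (hα i).ne'
    rw [← floor_intCast_div (hα i), sub_eq_add_neg, ← Int.floor_neg, ← Int.floor_intCast_add, hβ]
    congr 1
    push_cast
    field_simp
    ring
  rw [sVal, Finset.sum_congr rfl fun i _ => h i, Finset.sum_sub_distrib]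
  simp
  ring

theorem epsQ_eq_one_iff {ν : ℕ} {α β : Fin ν → ℤ} {i : Fin ν} (hα : 0 < α i) (l₁ l₂ : ℤ) :
    epsQ ν α β i l₁ l₂ = 1 ↔ (l₁ + l₂) * β i / α i = l₁ * β i / α i + l₂ * β i / α i + 1 := by
  have h : epsQ ν α β i l₁ l₂ =
      (((l₁ + l₂) * β i / α i - l₁ * β i / α i - l₂ * β i / α i : ℤ) : ℚ) := by
    simp only [epsQ, Int.fract, floor_intCast_div hα]
    push_cast
    ring
  rw [h, ← Int.cast_one, Int.cast_inj]
  omega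

theorem prod_X_mem_Jl {ν : ℕ} {b0 : ℤ} {α ω β : Fin ν → ℤ} {l₁ l₂ : ℤ} (h₁ : 1 ≤ l₁)
    (h₂ : 1 ≤ l₂) (hs₁ : 0 ≤ sVal ν b0 α ω l₁) (hs₂ : 0 ≤ sVal ν b0 α ω l₂) {U : Finset (Fin ν)}
    (hU : ∀ i, epsQ ν α β i l₁ l₂ = 1 → i ∈ U) :
    ∏ i ∈ U, (X i : MvPolynomial (Fin ν) ℂ) ∈ Jl ν b0 α ω β (l₁ + l₂) := by
  refine Ideal.mem_of_dvd _ ?_ (Ideal.subset_span ⟨l₁, l₂, h₁, h₂, rfl, hs₁, hs₂, rfl⟩)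
  rw [← Finset.prod_subset (Finset.subset_univ U) fun i _ hi => by
    rw [if_neg (mt (hU i) hi), pow_zero]]
  refine Finset.prod_dvd_prod_of_dvd _ _ fun i _ => ?_
  split_ifs <;> simp

/-- Assume `b₀ ≥ ν` and let `M` be of full rank type. Then `Q(1) = b₀ − ν + 1` and for every
integer `l ≥ 2`, `Q(l)` is the number of indices `i` such that `l` is a convergent numerator of
`α_i/β_i`; i.e. `P_{m_X/m_X²}(t) = (b₀ − ν + 1)t + Σ_i f_{α_i,β_i}(t)`. -/
theorem stmt15 (ν : ℕ) (hν : 3 ≤ ν) (b0 : ℤ) (α ω : Fin ν → ℤ)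
    (hω : ∀ i, 0 < ω i) (hωα : ∀ i, ω i < α i) (hcop : ∀ i, Int.gcd (α i) (ω i) = 1)
    (e : ℚ) (he : e = -(b0 : ℚ) + ∑ i, (ω i : ℚ) / (α i : ℚ)) (hneg : e < 0)
    (β : Fin ν → ℤ) (hβ : ∀ i, β i = α i - ω i)
    (hb0 : (ν : ℤ) ≤ b0)
    (M : Matrix (Fin (ν - 2)) (Fin ν) ℂ) (hM : FullRankType ν M) :
    ((hdim (Jl ν b0 α ω β 1 + IM M) (sVal ν b0 α ω 1).toNat : ℤ) = b0 - ν + 1) ∧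
    (∀ l : ℤ, 2 ≤ l →
      hdim (Jl ν b0 α ω β l + IM M) (sVal ν b0 α ω l).toNat =
        Set.ncard {i : Fin ν | IsConvergentNumerator (α i) (β i) l}) := by
  have hα : ∀ i, 0 < α i := fun i => (hω i).trans (hωα i)
  have hβ0 : ∀ i, 0 < β i := fun i => by have := hωα i; rw [hβ]; omega
  have hβα : ∀ i, β i < α i := fun i => by have := hω i; rw [hβ]; omega
  have hcopβ : ∀ i, IsCoprime (α i) (β i) := by
    intro i
    have h := (Int.isCoprime_iff_gcd_eq_one.2 (hcop i)).neg_right.add_mul_left_right 1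
    rwa [show -ω i + α i * 1 = β i by rw [hβ]; ring] at h
  have hF : ∀ l : ℤ, 0 ≤ l → ∀ i, 0 ≤ l * β i / α i := fun l hl i =>
    Int.ediv_nonneg (mul_nonneg hl (hβ0 i).le) (hα i).le
  have hs : ∀ l : ℤ, 0 ≤ l → 0 ≤ sVal ν b0 α ω l := fun l hl => by
    rw [sVal_eq b0 hα hβ]
    exact add_nonneg (mul_nonneg hl (by omega)) (Finset.sum_nonneg fun i _ => hF l hl i)
  constructor
  · have hX : Xset ν b0 α ω β 1 = ∅ := by
      ext p
      simp only [Xset, Set.mem_ofPred_eq, Set.mem_empty_iff_false, iff_false]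
      rintro ⟨l₁, l₂, h₁, h₂, h, -⟩
      omega
    have hs1 : sVal ν b0 α ω 1 = b0 - ν := by
      rw [sVal_eq b0 hα hβ, Finset.sum_eq_zero fun i _ => ?_]
      · ring
      · rw [one_mul]
        exact Int.ediv_eq_zero_of_lt (hβ0 i).le (hβα i)
    rw [Jl, hX, Ideal.span_empty, Submodule.add_eq_sup, bot_sup_eq, hdim_IM (by omega) hM, hs1]
    omega
  · intro l hl
    classical
    let S : Finset (Fin ν) := Finset.univ.filter fun i => 1 ≤ l * β i / α i
    let D : Finset (Fin ν) := Finset.univ.filter fun i => IsConvergentNumerator (α i) (β i) l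
    have hiff : ∀ i, IsConvergentNumerator (α i) (β i) l ↔ _ := fun i =>
      isConvergentNumerator_iff (hβ0 i) (hβα i) (hcopβ i) hl
    have hD : ∀ i ∈ D, ∀ l₁ l₂ : ℤ, 1 ≤ l₁ → 1 ≤ l₂ → l₁ + l₂ = l → epsQ ν α β i l₁ l₂ = 1 := by
      intro i hi l₁ l₂ h₁ h₂ h
      have hlt := (hiff i).1 (Finset.mem_filter.1 hi).2 l₁ l₂ h₁ h₂ h
      rw [epsQ_eq_one_iff (hα i), h]
      have hle : l * β i / α i < l₁ * β i / α i + l₂ * β i / α i + 2 := by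
        rw [Int.ediv_lt_iff_lt_mul (hα i), ← h]
        have e₁ := Int.lt_ediv_add_one_mul_self (l₁ * β i) (hα i)
        have e₂ := Int.lt_ediv_add_one_mul_self (l₂ * β i) (hα i)
        linarith
      omega
    have hS : ∀ l₁ l₂ : ℤ, 1 ≤ l₁ → 1 ≤ l₂ → l₁ + l₂ = l → ∀ i, epsQ ν α β i l₁ l₂ = 1 → i ∈ S := by
      intro l₁ l₂ h₁ h₂ h i hi
      rw [epsQ_eq_one_iff (hα i), h] at hi
      have := hF l₁ (by omega) i
      have := hF l₂ (by omega) i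
      simp only [S, Finset.mem_filter, Finset.mem_univ, true_and]
      omega
    have hmem : ∀ l₁ l₂ : ℤ, 1 ≤ l₁ → 1 ≤ l₂ → l₁ + l₂ = l → ∀ U : Finset (Fin ν),
        (∀ i, epsQ ν α β i l₁ l₂ = 1 → i ∈ U) → ∏ i ∈ U, X i ∈ Jl ν b0 α ω β l := by
      rintro l₁ l₂ h₁ h₂ rfl U hU
      exact prod_X_mem_Jl h₁ h₂ (hs _ (by omega)) (hs _ (by omega)) hU
    have hcard : Set.ncard {i : Fin ν | IsConvergentNumerator (α i) (β i) l} = D.card := by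
      rw [← Set.ncard_coe_finset]
      simp [D]
    rw [hcard, Submodule.add_eq_sup]
    refine hdim_sup_IM_eq_card (S := S) (by omega) hM _ ?_ ?_ ?_ ?_ ?_
    · intro i hi
      exact hS 1 (l - 1) le_rfl (by omega) (by ring) i
        (hD i hi 1 (l - 1) le_rfl (by omega) (by ring))
    · have h1 : (S.card : ℤ) ≤ sVal ν b0 α ω l := by
        rw [sVal_eq b0 hα hβ, Finset.card_eq_sum_ones, Nat.cast_sum]
        have h2 : ∑ i ∈ S, ((1 : ℕ) : ℤ) ≤ ∑ i ∈ S, l * β i / α i :=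
          Finset.sum_le_sum fun i hi => by simpa using (Finset.mem_filter.1 hi).2
        have h3 : ∑ i ∈ S, l * β i / α i ≤ ∑ i, l * β i / α i :=
          Finset.sum_le_sum_of_subset_of_nonneg (Finset.subset_univ _)
            fun i _ _ => hF l (by omega) i
        have h4 : 0 ≤ l * (b0 - ν) := mul_nonneg (by omega) (by omega)
        linarith
      omega
    · intro i hi
      rw [Jl, Ideal.span_le]
      rintro _ ⟨l₁, l₂, h₁, h₂, h, -, -, rfl⟩
      refine Ideal.mem_span_singleton.2 ?_
      refine Dvd.dvd.trans ?_ (Finset.dvd_prod_of_mem _ (Finset.mem_univ i))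
      rw [if_pos (hD i hi l₁ l₂ h₁ h₂ h), pow_one]
    · exact hmem 1 (l - 1) le_rfl (by omega) (by ring) S
        (hS 1 (l - 1) le_rfl (by omega) (by ring))
    · intro n _ hnD
      have hn : ¬ IsConvergentNumerator (α n) (β n) l := by simpa [D] using hnD
      rw [hiff] at hn
      push Not at hn
      obtain ⟨l₁, l₂, h₁, h₂, h, hle⟩ := hn
      refine hmem l₁ l₂ h₁ h₂ h _ fun i hi => Finset.mem_erase.2 ⟨?_, hS l₁ l₂ h₁ h₂ h i hi⟩
      rintro rfl
      rw [epsQ_eq_one_iff (hα i), h] at hi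
      omega
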